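/- Corrective flips preserve the pair of permutations associated to a diagram: if D' is obtained from a •/◦/+-diagram D (stones colored black iff they are uncrossings) by performing a corrective flip, then D and D' have the same Ferrers shape, hence the same permutation v, and the permutations of the pipe dreams of D and D' are equal. -/

import Mathlib

namespace GoPaper

/-- Fillings of a box: black stone, white stone, or plus. -/
inductive Fill : Type
  | black | white | plus
deriving DecidableEq

/-- A Ferrers shape inside the `k × (n-k)` rectangle (rows indexed from the top by
`0,…,k-1`, columns from the left by `0,…,n-k-1`), given by its set of boxes,
which is closed to the northwest. -/
structure Shape (n k : ℕ) where
  boxes : Finset (ℕ × ℕ)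
  row_lt : ∀ b ∈ boxes, b.1 < k
  col_lt : ∀ b ∈ boxes, b.2 < n - k
  nw_closed : ∀ b ∈ boxes, ∀ r c : ℕ, r ≤ b.1 → c ≤ b.2 → (r, c) ∈ boxes

/-- A `•/◦/+`-diagram: a Ferrers shape together with a filling of its boxes. -/
structure Diagram (n k : ℕ) where
  S : Shape n k
  fill : ℕ × ℕ → Fill

/-- `inIn b c` means `c ∈ b^in`, i.e. `c` is weakly to the right of and weakly below `b`. -/
def inIn (b c : ℕ × ℕ) : Prop := b.1 ≤ c.1 ∧ b.2 ≤ c.2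

instance (b c : ℕ × ℕ) : Decidable (inIn b c) := by unfold inIn; infer_instance

/-- The simple transposition `s_i` (0-indexed), as a permutation of `ℕ`. -/
def sw (i : ℕ) : Equiv.Perm ℕ := Equiv.swap i (i + 1)

/-- The (0-indexed) index of the simple transposition labelling box `b`:
the top-left box `(0,0)` is labelled `n-k-1`, indices decrease to the right and
increase downward. -/
def lab (n k : ℕ) (b : ℕ × ℕ) : ℕ := n - k - 1 + b.1 - b.2

/-- The simple transposition labelling box `b`. -/
def sbox (n k : ℕ) (b : ℕ × ℕ) : Equiv.Perm ℕ := sw (lab n k b)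

/-- Coxeter length of a permutation of `S_n` (supported on `{0,…,n-1}`): the
number of inversions. -/
def len (n : ℕ) (π : Equiv.Perm ℕ) : ℕ :=
  ((Finset.range n ×ˢ Finset.range n).filter (fun p => p.1 < p.2 ∧ π p.2 < π p.1)).card

/-- A canonical reading order on the boxes of a shape: rows from bottom to top,
each row from right to left (a valid reading order; all notions read off in a
reading order are independent of its choice). -/
def readingList {n k : ℕ} (S : Shape n k) : List (ℕ × ℕ) :=
  (((List.range k).reverse).flatMap fun r =>
      ((List.range (n - k)).reverse).map fun c => (r, c)).filter
    (fun b => decide (b ∈ S.boxes))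

/-- Product, in the reading order, of the box transpositions over boxes satisfying `p`. -/
def readProd {n k : ℕ} (D : Diagram n k) (p : ℕ × ℕ → Bool) : Equiv.Perm ℕ :=
  (((readingList D.S).filter p).map fun b => sbox n k b).prod

/-- The permutation `u` of the pipe dream of `D`: product of labels of the stone boxes. -/
def permU {n k : ℕ} (D : Diagram n k) : Equiv.Perm ℕ :=
  readProd D (fun b => decide (D.fill b ≠ Fill.plus))

/-- The Grassmannian permutation `v = v_λ`: product of labels of all boxes. -/
def permV {n k : ℕ} (D : Diagram n k) : Equiv.Perm ℕ := readProd D (fun _ => true)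

/-- `u_{b^in}^D`: product of the labels of the stone boxes of `b^in` other than `b`. -/
def uIn {n k : ℕ} (D : Diagram n k) (b : ℕ × ℕ) : Equiv.Perm ℕ :=
  readProd D (fun c => decide (inIn b c ∧ c ≠ b ∧ D.fill c ≠ Fill.plus))

/-- `v_{b^in}`: product of the labels of all boxes of `b^in`. -/
def vIn {n k : ℕ} (D : Diagram n k) (b : ℕ × ℕ) : Equiv.Perm ℕ :=
  readProd D (fun c => decide (inIn b c))

/-- `u_b^D`: the label of `b` if `b` contains a stone, the identity if it contains a plus. -/
def uBox {n k : ℕ} (D : Diagram n k) (b : ℕ × ℕ) : Equiv.Perm ℕ :=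
  if D.fill b = Fill.plus then 1 else sbox n k b

/-- The length-drop condition `ℓ(u_{b^in} u_b s_b) < ℓ(u_{b^in} u_b)` at box `b`. -/
def lenDrop {n k : ℕ} (D : Diagram n k) (b : ℕ × ℕ) : Prop :=
  len n (uIn D b * uBox D b * sbox n k b) < len n (uIn D b * uBox D b)

/-- `b` violates the distinguished property: the length drops at `b`, but `b` is
not filled with a black stone. -/
def ViolatesDist {n k : ℕ} (D : Diagram n k) (b : ℕ × ℕ) : Prop :=
  b ∈ D.S.boxes ∧ D.fill b ≠ Fill.black ∧ lenDrop D b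

/-- `D` is a Go-diagram: a box contains a black stone iff the length drops there. -/
def IsGoDiagram {n k : ℕ} (D : Diagram n k) : Prop :=
  ∀ b ∈ D.S.boxes, (D.fill b = Fill.black ↔ lenDrop D b)

/-- Number of boxes of `D` with filling `f`. -/
def countFill {n k : ℕ} (D : Diagram n k) (f : Fill) : ℕ :=
  (D.S.boxes.filter (fun b => D.fill b = f)).card

/-- Length of row `r` of the shape. -/
def rowLen {n k : ℕ} (S : Shape n k) (r : ℕ) : ℕ :=
  ((Finset.range (n - k)).filter (fun c => (r, c) ∈ S.boxes)).card

/-- The (0-indexed) label of the vertical boundary step in row `r`. -/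
def vlab {n k : ℕ} (S : Shape n k) (r : ℕ) : ℕ := r + (n - k) - rowLen S r

/-- The (0-indexed) label of the horizontal boundary step in column `c`. -/
def hlab {n k : ℕ} (S : Shape n k) (c : ℕ) : ℕ :=
  (n - k - 1 - c) + ((Finset.range k).filter (fun r => c < rowLen S r)).card

/-- Labels of the pipes of the pipe dream of `D`: `pipeAux D fuel true b` is the
label of the pipe entering box `b` from the bottom, `pipeAux D fuel false b` the
label of the pipe entering from the right (stones are crossing tiles, pluses are
elbow tiles; pipes enter from the southeast boundary). -/
def pipeAux {n k : ℕ} (D : Diagram n k) : ℕ → Bool → ℕ × ℕ → ℕ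
  | 0, _, _ => 0
  | fuel + 1, true, b =>
      if (b.1 + 1, b.2) ∈ D.S.boxes then
        (if D.fill (b.1 + 1, b.2) = Fill.plus then pipeAux D fuel false (b.1 + 1, b.2)
          else pipeAux D fuel true (b.1 + 1, b.2))
      else hlab D.S b.2
  | fuel + 1, false, b =>
      if (b.1, b.2 + 1) ∈ D.S.boxes then
        (if D.fill (b.1, b.2 + 1) = Fill.plus then pipeAux D fuel true (b.1, b.2 + 1)
          else pipeAux D fuel false (b.1, b.2 + 1))
      else vlab D.S b.1

/-- The label of the pipe entering box `b` from the bottom. -/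
def pipeB {n k : ℕ} (D : Diagram n k) (b : ℕ × ℕ) : ℕ := pipeAux D (n + 1) true b

/-- The label of the pipe entering box `b` from the right. -/
def pipeR {n k : ℕ} (D : Diagram n k) (b : ℕ × ℕ) : ℕ := pipeAux D (n + 1) false b

/-- `b` is a box of `D` containing a stone (black or white). -/
def IsStone {n k : ℕ} (D : Diagram n k) (b : ℕ × ℕ) : Prop :=
  b ∈ D.S.boxes ∧ D.fill b ≠ Fill.plus

/-- The (unordered) pair of pipes passing through box `b`. -/
def pipePair {n k : ℕ} (D : Diagram n k) (b : ℕ × ℕ) : Finset ℕ :=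
  {pipeB D b, pipeR D b}

/-- `b, c` form a crossing/uncrossing pair: the same two pipes cross at `b`
(the pipe entering from the bottom is larger), flow northwest, and next
uncross at `c`. -/
def CrossUncrossPair {n k : ℕ} (D : Diagram n k) (b c : ℕ × ℕ) : Prop :=
  IsStone D b ∧ IsStone D c ∧ b ≠ c ∧
  pipeR D b < pipeB D b ∧ pipeB D c < pipeR D c ∧
  pipePair D b = pipePair D c ∧ inIn c b ∧
  ∀ d : ℕ × ℕ, IsStone D d → pipePair D d = pipePair D b →
    inIn c d → inIn d b → d = b ∨ d = c

/-- Stones of `D` are colored black iff they are uncrossing tiles. -/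
def BlackIffUncross {n k : ℕ} (D : Diagram n k) : Prop :=
  ∀ b ∈ D.S.boxes, (D.fill b = Fill.black ↔ (D.fill b ≠ Fill.plus ∧ pipeB D b < pipeR D b))

/-- Change the filling of box `b` to `f`. -/
def setFill {n k : ℕ} (D : Diagram n k) (b : ℕ × ℕ) (f : Fill) : Diagram n k :=
  ⟨D.S, fun c => if c = b then f else D.fill c⟩

/-- Recolor the stones of `D` so that a stone is black iff it is an uncrossing. -/
def recolor {n k : ℕ} (D : Diagram n k) : Diagram n k :=
  ⟨D.S, fun b => if D.fill b = Fill.plus then Fill.plus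
    else if pipeB D b < pipeR D b then Fill.black else Fill.white⟩

/-- Equality of diagrams: same shape and the same filling on every box of the shape. -/
def DEq {n k : ℕ} (D D' : Diagram n k) : Prop :=
  D.S = D'.S ∧ ∀ b ∈ D.S.boxes, D.fill b = D'.fill b

/-- The diagram obtained by switching the plus at `p` with the stone at `t`, then
recoloring stones black iff they are uncrossings. -/
def flipPlusWith {n k : ℕ} (D : Diagram n k) (p t : ℕ × ℕ) : Diagram n k :=
  recolor (setFill (setFill D p Fill.white) t Fill.plus)

/-- `(p, t)` is a legal corrective-flip pair for `D`: `p` is a plus violating the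
distinguished property, and `t` is either the white stone `w` with which it violates
the distinguished property (i.e. placing a crossing at `p` makes `(w, p)` a
crossing/uncrossing pair), or `w`'s uncrossing partner, if it exists. -/
def IsFlipPair {n k : ℕ} (D : Diagram n k) (p t : ℕ × ℕ) : Prop :=
  p ∈ D.S.boxes ∧ D.fill p = Fill.plus ∧ lenDrop D p ∧
  ∃ w : ℕ × ℕ, CrossUncrossPair (setFill D p Fill.white) w p ∧
    (t = w ∨ CrossUncrossPair D w t)

/-- `D'` is obtained from `D` by performing a corrective flip. -/
def IsCorrectiveFlip {n k : ℕ} (D D' : Diagram n k) : Prop :=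
  ∃ p t : ℕ × ℕ, IsFlipPair D p t ∧ DEq D' (flipPlusWith D p t)

/-- Product of the simple transpositions along a word. -/
def wordProd (w : List ℕ) : Equiv.Perm ℕ := (w.map sw).prod

/-- Bruhat order on `S_n`: `u ≤ v` iff some reduced word for `u` is a subword of
some reduced word for `v`. -/
def BruhatLE (n : ℕ) (u v : Equiv.Perm ℕ) : Prop :=
  ∃ wv : List ℕ, (∀ i ∈ wv, i + 1 < n) ∧ wordProd wv = v ∧ wv.length = len n v ∧
    ∃ wu : List ℕ, wu.Sublist wv ∧ wordProd wu = u ∧ wu.length = len n u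

/-- Componentwise order on finite subsets of `ℕ`. -/
def FinsetLE (S T : Finset ℕ) : Prop :=
  List.Forall₂ (· ≤ ·) (S.sort (· ≤ ·)) (T.sort (· ≤ ·))

/-- Strict componentwise order on finite subsets of `ℕ`. -/
def FinsetLT (S T : Finset ℕ) : Prop := FinsetLE S T ∧ S ≠ T

/-- The (0-indexed) top set `{n-k, …, n-1}` (the set `{n-k+1, …, n}` of the paper). -/
def topSet (n k : ℕ) : Finset ℕ := (Finset.range n).filter (fun i => n - k ≤ i)

/-- The set `I_b = u_{b^in} u_b (v_{b^in})⁻¹ v {n, n-1, …, n-k+1}`. -/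
def Iset {n k : ℕ} (D : Diagram n k) (b : ℕ × ℕ) : Finset ℕ :=
  (topSet n k).image (fun x => (uIn D b * uBox D b * (vIn D b)⁻¹ * permV D) x)

/-- The set `J_b = u_{b^in} (v_{b^in})⁻¹ v {n, n-1, …, n-k+1}`. -/
def Jset {n k : ℕ} (D : Diagram n k) (b : ℕ × ℕ) : Finset ℕ :=
  (topSet n k).image (fun x => (uIn D b * (vIn D b)⁻¹ * permV D) x)

/-- `I_λ`: the set of labels of the vertical boundary steps of the shape. -/
def Ilam {n k : ℕ} (S : Shape n k) : Finset ℕ := (Finset.range k).image (fun r => vlab S r)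

/-- The Plücker coordinate of a `k × n` matrix at a `k`-subset `I ⊆ {0,…,n-1}`. -/
noncomputable def plucker {n k : ℕ} (A : Matrix (Fin k) (Fin n) ℝ) (I : Finset ℕ) : ℝ :=
  Matrix.det (Matrix.of fun i j : Fin k =>
    if h : (I.sort (· ≤ ·)).getD (j : ℕ) 0 < n then A i ⟨(I.sort (· ≤ ·)).getD (j : ℕ) 0, h⟩
    else 0)

/-- Full-rank `k × n` real matrices: representatives of points of `Gr(k,n)`. -/
def GrRep (k n : ℕ) : Type := {A : Matrix (Fin k) (Fin n) ℝ // A.rank = k}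

instance (k n : ℕ) : TopologicalSpace (GrRep k n) := by unfold GrRep; infer_instance

/-- Row equivalence of full-rank matrices. -/
def grSetoid (k n : ℕ) : Setoid (GrRep k n) where
  r A B := ∃ g : Matrix (Fin k) (Fin k) ℝ, IsUnit g.det ∧ B.1 = g * A.1
  iseqv := by
    refine ⟨fun A => ⟨1, ?_, ?_⟩, ?_, ?_⟩
    · simp
    · simp
    · rintro A B ⟨g, hg, hB⟩
      refine ⟨g⁻¹, Matrix.isUnit_nonsing_inv_det g hg, ?_⟩
      rw [hB, ← Matrix.mul_assoc, Matrix.nonsing_inv_mul g hg, Matrix.one_mul]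
    · rintro A B C ⟨g, hg, hB⟩ ⟨h, hh, hC⟩
      exact ⟨h * g, by rw [Matrix.det_mul]; exact hh.mul hg,
        by rw [hC, hB, Matrix.mul_assoc]⟩

/-- The Grassmannian `Gr(k,n)`, as the quotient of full-rank `k × n` matrices by
row equivalence, with the quotient topology. -/
def Gr (k n : ℕ) : Type := Quotient (grSetoid k n)

instance (k n : ℕ) : TopologicalSpace (Gr k n) := by
  unfold Gr; exact instTopologicalSpaceQuotient

/-- Matrix representatives of the Deodhar component indexed by a Go-diagram `D`:
`Δ_{I_b} = 0` for white-stone boxes, `Δ_{I_b} ≠ 0` for plus boxes, `Δ_{I_λ} ≠ 0`,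
and `Δ_S = 0` whenever `S ≱ I_λ`. -/
def deodharRep {n k : ℕ} (D : Diagram n k) : Set (Matrix (Fin k) (Fin n) ℝ) :=
  {A | (∀ b ∈ D.S.boxes, D.fill b = Fill.white → plucker A (Iset D b) = 0) ∧
      (∀ b ∈ D.S.boxes, D.fill b = Fill.plus → plucker A (Iset D b) ≠ 0) ∧
      plucker A (Ilam D.S) ≠ 0 ∧
      (∀ S : Finset ℕ, S ⊆ Finset.range n → S.card = k →
        ¬ FinsetLE (Ilam D.S) S → plucker A S = 0)}

/-- The Deodhar component in `Gr(k,n)` indexed by a Go-diagram `D`. -/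
def deodhar {n k : ℕ} (D : Diagram n k) : Set (Gr k n) :=
  {x | ∃ A : GrRep k n, Quotient.mk (grSetoid k n) A = x ∧ A.1 ∈ deodharRep D}

/-- The dimension of the Deodhar component indexed by `D` (by Deodhar's theorem,
the component is homeomorphic to `ℝ^{#black} × (ℝ \ {0})^{#plus}`). -/
def dimD {n k : ℕ} (D : Diagram n k) : ℕ :=
  countFill D Fill.black + countFill D Fill.plus

/-- The positroid cell of shape `S` and permutation `u`: the union of the Deodhar
components indexed by Go-diagrams of shape `S` with pipe-dream permutation `u`. -/
def positroid {n k : ℕ} (S : Shape n k) (u : Equiv.Perm ℕ) : Set (Gr k n) :=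
  {x | ∃ D : Diagram n k, D.S = S ∧ IsGoDiagram D ∧ permU D = u ∧ x ∈ deodhar D}

/-- A Le-diagram: no black stones, and no white stone with a plus above it in its
column and a plus to its left in its row. -/
def IsLeDiagram {n k : ℕ} (D : Diagram n k) : Prop :=
  (∀ b ∈ D.S.boxes, D.fill b ≠ Fill.black) ∧
  ∀ b ∈ D.S.boxes, D.fill b = Fill.white →
    ¬((∃ r : ℕ, r < b.1 ∧ D.fill (r, b.2) = Fill.plus) ∧
      (∃ c : ℕ, c < b.2 ∧ D.fill (b.1, c) = Fill.plus))

/-- A Le-move: on a rectangle with pluses in the top-left, top-right and bottom-left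
corners, a white stone in the bottom-right corner, and white stones elsewhere,
exchange the top-left plus with the bottom-right white stone. -/
def IsLeMove {n k : ℕ} (D D' : Diagram n k) : Prop :=
  D'.S = D.S ∧
  ∃ r1 r2 c1 c2 : ℕ, r1 < r2 ∧ c1 < c2 ∧ (r2, c2) ∈ D.S.boxes ∧
    D.fill (r1, c1) = Fill.plus ∧ D.fill (r1, c2) = Fill.plus ∧
    D.fill (r2, c1) = Fill.plus ∧ D.fill (r2, c2) = Fill.white ∧
    (∀ r c : ℕ, r1 ≤ r → r ≤ r2 → c1 ≤ c → c ≤ c2 →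
      ¬((r = r1 ∨ r = r2) ∧ (c = c1 ∨ c = c2)) → D.fill (r, c) = Fill.white) ∧
    D'.fill (r1, c1) = Fill.white ∧ D'.fill (r2, c2) = Fill.plus ∧
    (∀ b : ℕ × ℕ, b ≠ (r1, c1) → b ≠ (r2, c2) → D'.fill b = D.fill b)

/-- The first black stone or plus strictly to the right of `b` in its row. -/
def firstRight {n k : ℕ} (D : Diagram n k) (b : ℕ × ℕ) : Option (ℕ × ℕ) :=
  ((List.range (n - k)).map fun t => (b.1, b.2 + 1 + t)).find?
    (fun x => decide (x ∈ D.S.boxes ∧ D.fill x ≠ Fill.white))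

/-- The first black stone or plus strictly below `b` in its column. -/
def firstDown {n k : ℕ} (D : Diagram n k) (b : ℕ × ℕ) : Option (ℕ × ℕ) :=
  ((List.range k).map fun t => (b.1 + 1 + t, b.2)).find?
    (fun x => decide (x ∈ D.S.boxes ∧ D.fill x ≠ Fill.white))

/-- `x` is (relative to the oracle `pf`) the partner of some black stone of `b^in`
other than `b`. -/
noncomputable def partneredWhite {n k : ℕ} (D : Diagram n k) (pf : ℕ × ℕ → Option (ℕ × ℕ))
    (b x : ℕ × ℕ) : Bool :=
  D.S.boxes.toList.any fun d =>
    decide (inIn b d ∧ d ≠ b ∧ D.fill d = Fill.black ∧ pf d = some x)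

/-- Step 5 of the partner algorithm: the path from `b` travelling right
(`dir = true`) or down (`dir = false`), given an oracle `pf` of previously
assigned partners; turns at pluses, jumps at black stones to their partners,
and turns at white stones partnered with black stones of `b^in`. -/
noncomputable def pathAux {n k : ℕ} (D : Diagram n k) (pf : ℕ × ℕ → Option (ℕ × ℕ)) (b : ℕ × ℕ) :
    ℕ → Bool → ℕ × ℕ → List (ℕ × ℕ)
  | 0, _, _ => []
  | fuel + 1, dir, x =>
      let x' : ℕ × ℕ := if dir then (x.1, x.2 + 1) else (x.1 + 1, x.2)
      if x' ∈ D.S.boxes then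
        match D.fill x' with
        | Fill.plus => x' :: pathAux D pf b fuel (!dir) x'
        | Fill.black =>
            match pf x' with
            | some q => x' :: q :: pathAux D pf b fuel (!dir) q
            | none => [x']
        | Fill.white =>
            if partneredWhite D pf b x' then x' :: pathAux D pf b fuel (!dir) x'
            else x' :: pathAux D pf b fuel dir x'
      else []

/-- One step of the partner algorithm at box `b`, given an oracle `pf` of
previously assigned partners. Returns (partner of `b`, path `P_b`, path `Q_b`). -/
noncomputable def partnerCore {n k : ℕ} (D : Diagram n k) (pf : ℕ × ℕ → Option (ℕ × ℕ)) (b : ℕ × ℕ) :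
    Option (ℕ × ℕ) × List (ℕ × ℕ) × List (ℕ × ℕ) :=
  match firstRight D b, firstDown D b with
  | some c, some d =>
      let e : ℕ × ℕ := (d.1, c.2)
      if e ∈ D.S.boxes ∧
          (¬ ∃ i ∈ Finset.range d.1, b.1 < i ∧ (i, c.2) ∈ D.S.boxes ∧
            D.fill (i, c.2) ≠ Fill.white) ∧
          (¬ ∃ j ∈ Finset.range c.2, b.2 < j ∧ (d.1, j) ∈ D.S.boxes ∧
            D.fill (d.1, j) ≠ Fill.white) then
        if D.fill e = Fill.white then
          (some e,
            b :: (((List.range (c.2 - b.2)).map fun t => (b.1, b.2 + 1 + t)) ++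
              ((List.range (d.1 - b.1)).map fun t => (b.1 + 1 + t, c.2))),
            b :: (((List.range (d.1 - b.1)).map fun t => (b.1 + 1 + t, b.2)) ++
              ((List.range (c.2 - b.2)).map fun t => (d.1, b.2 + 1 + t))))
        else
          let P := b :: pathAux D pf b (n + 1) true b
          let Q := b :: pathAux D pf b (n + 1) false b
          let common := P.filter (fun m => decide (m ∈ Q))
          match common.find? (fun m => common.all fun m' => decide (inIn m m')) with
          | some m => (if D.fill m = Fill.white then some m else none, P, Q)
          | none => (none, P, Q)
      else (none, [], [])
  | _, _ => (none, [], [])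

/-- Iterated partner assignment (the recursion bottoms out along the partial
order `≼`, whose chains have length at most `n`). -/
noncomputable def partnerAux {n k : ℕ} (D : Diagram n k) : ℕ → ℕ × ℕ → Option (ℕ × ℕ)
  | 0, _ => none
  | m + 1, b => (partnerCore D (partnerAux D m) b).1

/-- The partner of box `b` in `D` (if any), per the recursive partner algorithm. -/
noncomputable def partner {n k : ℕ} (D : Diagram n k) (b : ℕ × ℕ) : Option (ℕ × ℕ) :=
  partnerAux D (n + 2) b

/-- The path `P_b` of the partner algorithm. -/
noncomputable def pathP {n k : ℕ} (D : Diagram n k) (b : ℕ × ℕ) : List (ℕ × ℕ) :=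
  (partnerCore D (partnerAux D (n + 1)) b).2.1

/-- The path `Q_b` of the partner algorithm. -/
noncomputable def pathQ {n k : ℕ} (D : Diagram n k) (b : ℕ × ℕ) : List (ℕ × ℕ) :=
  (partnerCore D (partnerAux D (n + 1)) b).2.2

/-- `f(D,b)`: replace with pluses all black stones in boxes `c ≺ b` and all white
stones that are partners of such boxes. -/
noncomputable def fDb {n k : ℕ} (D : Diagram n k) (b : ℕ × ℕ) : Diagram n k :=
  ⟨D.S, fun x =>
    if (D.fill x = Fill.black ∧ inIn b x ∧ x ≠ b) ∨
        (∃ c ∈ D.S.boxes, inIn b c ∧ c ≠ b ∧ D.fill c = Fill.black ∧ partner D c = some x)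
    then Fill.plus else D.fill x⟩

/-- Replace all black stones of `D`, and all of their partners, with pluses. -/
noncomputable def reduceGo {n k : ℕ} (D : Diagram n k) : Diagram n k :=
  ⟨D.S, fun x =>
    if D.fill x = Fill.black ∨
        (∃ c ∈ D.S.boxes, D.fill c = Fill.black ∧ partner D c = some x)
    then Fill.plus else D.fill x⟩

/-- Product, in a reading order, of the labels of the stone boxes of `b^in`. -/
def stonesProd {n k : ℕ} (D : Diagram n k) (b : ℕ × ℕ) : Equiv.Perm ℕ :=
  readProd D (fun c => decide (inIn b c ∧ D.fill c ≠ Fill.plus))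

/-- Property (P1) at `b`: the product of the labels of the stone boxes of `b^in`
is the same in `f(D,b)` as in `D`. -/
def P1 {n k : ℕ} (D : Diagram n k) (b : ℕ × ℕ) : Prop :=
  stonesProd (fDb D b) b = stonesProd D b

/-- Property (P2) at `b`: `b` has partner `p` iff `p` and `b` form a
crossing/uncrossing pair in the pipe dream of `f(D,b)`. -/
def P2 {n k : ℕ} (D : Diagram n k) (b : ℕ × ℕ) : Prop :=
  ∀ p : ℕ × ℕ, (partner D b = some p ↔ CrossUncrossPair (fDb D b) p b)

/-- `D` is a (nonempty) full `rows × cols` rectangle. -/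
def IsRectangle {n k : ℕ} (D : Diagram n k) (rows cols : ℕ) : Prop :=
  0 < rows ∧ 0 < cols ∧ D.S.boxes = Finset.range rows ×ˢ Finset.range cols

/-- A minimal violation: a rectangular diagram in which the only box violating the
distinguished property is the top-left corner, and the pair of pipes that should
uncross there initially cross in the bottom-right corner. -/
def IsMinimalViolation {n k : ℕ} (D : Diagram n k) (rows cols : ℕ) : Prop :=
  IsRectangle D rows cols ∧
  ViolatesDist D (0, 0) ∧
  (∀ b ∈ D.S.boxes, ViolatesDist D b → b = (0, 0)) ∧
  pipePair D (0, 0) = pipePair D (rows - 1, cols - 1) ∧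
  D.fill (rows - 1, cols - 1) ≠ Fill.plus ∧
  pipeR D (rows - 1, cols - 1) < pipeB D (rows - 1, cols - 1)


/-- `x` strictly precedes `y` in the reading order. -/
def readsBefore (x y : ℕ × ℕ) : Prop := y.1 < x.1 ∨ (x.1 = y.1 ∧ y.2 < x.2)

instance (x y : ℕ × ℕ) : Decidable (readsBefore x y) := by unfold readsBefore; infer_instance

theorem readsBefore_asymm {x y : ℕ × ℕ} (h : readsBefore x y) : ¬ readsBefore y x := by
  unfold readsBefore at *; omega

theorem readsBefore_trichotomy (x y : ℕ × ℕ) :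
    readsBefore x y ∨ x = y ∨ readsBefore y x := by
  obtain ⟨a, b⟩ := x
  obtain ⟨c, d⟩ := y
  simp only [readsBefore, Prod.mk.injEq]; omega

theorem mem_readingList {n k : ℕ} {S : Shape n k} {b : ℕ × ℕ} :
    b ∈ readingList S ↔ b ∈ S.boxes := by
  have h1 := S.row_lt b
  have h2 := S.col_lt b
  obtain ⟨r, c⟩ := b
  simp only [readingList, List.mem_filter, List.mem_flatMap, List.mem_reverse, List.mem_range,
    List.mem_map, Prod.mk.injEq, decide_eq_true_eq]
  constructor
  · exact fun h => h.2
  · exact fun h => ⟨⟨r, h1 h, c, h2 h, rfl, rfl⟩, h⟩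

theorem pairwise_readingList {n k : ℕ} (S : Shape n k) :
    (readingList S).Pairwise readsBefore := by
  unfold readingList
  apply List.Pairwise.filter
  rw [List.pairwise_flatMap]
  constructor
  · intro r _
    rw [List.pairwise_map, List.pairwise_reverse]
    exact List.pairwise_lt_range.imp fun h => Or.inr ⟨rfl, h⟩
  · rw [List.pairwise_reverse]
    refine List.pairwise_lt_range.imp fun h => ?_
    simp only [List.mem_map]
    rintro _ ⟨_, _, rfl⟩ _ ⟨_, _, rfl⟩
    exact Or.inl h

theorem filter_eq_append_of_pairwise {l : List (ℕ × ℕ)} (hl : l.Pairwise readsBefore)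
    (p q r : ℕ × ℕ → Bool) (hp : ∀ x ∈ l, p x = (q x || r x))
    (hqr : ∀ x ∈ l, ∀ y ∈ l, q x → r y → readsBefore x y) :
    l.filter p = l.filter q ++ l.filter r := by
  induction l with
  | nil => rfl
  | cons a l ih =>
    rw [List.pairwise_cons] at hl
    have ih := ih hl.2 (fun x hx => hp x (List.mem_cons_of_mem _ hx))
      (fun x hx y hy => hqr x (List.mem_cons_of_mem _ hx) y (List.mem_cons_of_mem _ hy))
    have ha := hp a List.mem_cons_self
    have hnot : r a → ¬ q a := fun h1 h2 =>
      have := hqr a List.mem_cons_self a List.mem_cons_self h2 h1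
      readsBefore_asymm this this
    by_cases hr : r a = true
    · have hnil : l.filter q = [] := by
        rw [List.filter_eq_nil_iff]
        intro x hx hq
        exact readsBefore_asymm (hl.1 x hx)
          (hqr x (List.mem_cons_of_mem _ hx) a List.mem_cons_self hq hr)
      have hq := hnot hr
      simp [ha, hr, hq, ih, hnil]
    · by_cases hq : q a = true
      · simp [ha, hr, hq, ih]
      · simp [ha, hr, hq, ih]

theorem readProd_eq_mul {n k : ℕ} (D : Diagram n k) (p q r : ℕ × ℕ → Bool)
    (hp : ∀ x ∈ D.S.boxes, p x = (q x || r x))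
    (hqr : ∀ x ∈ D.S.boxes, ∀ y ∈ D.S.boxes, q x → r y → readsBefore x y) :
    readProd D p = readProd D q * readProd D r := by
  unfold readProd
  rw [filter_eq_append_of_pairwise (pairwise_readingList D.S) p q r
    (fun x hx => hp x (mem_readingList.1 hx))
    (fun x hx y hy => hqr x (mem_readingList.1 hx) y (mem_readingList.1 hy))]
  simp

theorem readProd_congr {n k : ℕ} {D D' : Diagram n k} (hS : D.S = D'.S)
    {p q : ℕ × ℕ → Bool} (h : ∀ x ∈ D.S.boxes, p x = q x) :
    readProd D p = readProd D' q := by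
  unfold readProd
  rw [← hS, List.filter_congr fun x hx => h x (mem_readingList.1 hx)]

theorem readProd_singleton {n k : ℕ} (D : Diagram n k) {b : ℕ × ℕ} (hb : b ∈ D.S.boxes) :
    readProd D (fun x => decide (x = b)) = sbox n k b := by
  have hnd : (readingList D.S).Nodup :=
    (pairwise_readingList D.S).imp fun h e => by subst e; exact readsBefore_asymm h h
  have : (readingList D.S).filter (fun x => decide (x = b)) = [b] := by
    have h := List.filter_beq b (l := readingList D.S)
    rw [List.count_eq_one_of_mem hnd (mem_readingList.2 hb)] at h
    simpa [beq_eq_decide] using h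
  simp [readProd, this]

theorem readProd_apply_of_fixed {n k : ℕ} (D : Diagram n k) (p : ℕ × ℕ → Bool) (i : ℕ)
    (h : ∀ x ∈ D.S.boxes, p x → i ≠ lab n k x ∧ i ≠ lab n k x + 1) :
    readProd D p i = i := by
  unfold readProd
  have h' : ∀ x ∈ (readingList D.S).filter p, i ≠ lab n k x ∧ i ≠ lab n k x + 1 := by
    intro x hx
    rw [List.mem_filter, mem_readingList] at hx
    exact h x hx.1 hx.2
  generalize (readingList D.S).filter p = l at h'
  induction l with
  | nil => rfl
  | cons a l ih =>
    have ha := h' a List.mem_cons_self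
    rw [List.map_cons, List.prod_cons, Equiv.Perm.mul_apply,
      ih fun x hx => h' x (List.mem_cons_of_mem _ hx)]
    exact Equiv.swap_apply_of_ne_of_ne ha.1 ha.2

/-- Product of the labels of the stone boxes of `D` satisfying `Q`. -/
def stoneProd {n k : ℕ} (D : Diagram n k) (Q : ℕ × ℕ → Prop) [DecidablePred Q] :
    Equiv.Perm ℕ :=
  readProd D fun x => decide (Q x ∧ D.fill x ≠ Fill.plus)

/-- The permutation of the pipes just before box `b` is read. -/
def prefixPerm {n k : ℕ} (D : Diagram n k) (b : ℕ × ℕ) : Equiv.Perm ℕ :=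
  stoneProd D fun x => readsBefore x b

theorem stoneProd_congr {n k : ℕ} {D D' : Diagram n k} (hS : D.S = D'.S) (Q : ℕ × ℕ → Prop)
    [DecidablePred Q]
    (h : ∀ x ∈ D.S.boxes, Q x → (D.fill x = Fill.plus ↔ D'.fill x = Fill.plus)) :
    stoneProd D Q = stoneProd D' Q := by
  refine readProd_congr hS fun x hx => ?_
  have := h x hx
  simp only [decide_eq_decide]
  tauto

/-- Splitting the product over an initial segment `Q` of the reading order at a box `b`. -/
theorem stoneProd_split {n k : ℕ} (D : Diagram n k) (Q : ℕ × ℕ → Prop) [DecidablePred Q]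
    {b : ℕ × ℕ} (hb : b ∈ D.S.boxes) (hQb : Q b) (hQ : ∀ x, readsBefore x b → Q x) :
    stoneProd D Q = prefixPerm D b * uBox D b *
      stoneProd D (fun x => Q x ∧ readsBefore b x) := by
  have h1 : stoneProd D Q = prefixPerm D b *
      stoneProd D (fun x => Q x ∧ (x = b ∨ readsBefore b x)) := by
    apply readProd_eq_mul
    · intro x _
      rw [← Bool.decide_or, decide_eq_decide]
      have h1 := hQ x
      have h2 := readsBefore_trichotomy x b
      tauto
    · simp only [decide_eq_true_eq]
      rintro x _ y _ ⟨hx, _⟩ ⟨⟨_, rfl | hy⟩, _⟩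
      · exact hx
      · unfold readsBefore at *; omega
  rw [h1, mul_assoc]
  congr 1
  by_cases hf : D.fill b = Fill.plus
  · rw [uBox, if_pos hf, one_mul]
    refine readProd_congr rfl fun x _ => ?_
    rw [decide_eq_decide]
    constructor
    · rintro ⟨⟨h, rfl | h'⟩, h2⟩
      · exact absurd hf h2
      · exact ⟨⟨h, h'⟩, h2⟩
    · tauto
  · rw [uBox, if_neg hf, ← readProd_singleton D hb]
    apply readProd_eq_mul
    · intro x _
      rw [← Bool.decide_or, decide_eq_decide]
      constructor
      · tauto
      · rintro (rfl | h)
        · exact ⟨⟨hQb, Or.inl rfl⟩, hf⟩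
        · tauto
    · simp only [decide_eq_true_eq]
      rintro x _ y _ rfl ⟨⟨_, h⟩, _⟩
      exact h

/-- Placing a stone at `b` multiplies on the left by the transposition of the two pipes
entering `b`. -/
theorem stoneProd_toggle {n k : ℕ} {D D' : Diagram n k} (hS : D.S = D'.S)
    (Q : ℕ × ℕ → Prop) [DecidablePred Q] {b : ℕ × ℕ} (hb : b ∈ D.S.boxes) (hQb : Q b)
    (hQ : ∀ x, readsBefore x b → Q x) (hD : D.fill b = Fill.plus)
    (hD' : D'.fill b ≠ Fill.plus)
    (h : ∀ x ≠ b, (D.fill x = Fill.plus ↔ D'.fill x = Fill.plus)) :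
    stoneProd D' Q =
      Equiv.swap (prefixPerm D b (lab n k b)) (prefixPerm D b (lab n k b + 1)) *
        stoneProd D Q := by
  have hpre : prefixPerm D b = prefixPerm D' b := by
    refine stoneProd_congr hS _ fun x _ hx => h x ?_
    rintro rfl
    exact readsBefore_asymm hx hx
  have hpost : stoneProd D (fun x => Q x ∧ readsBefore b x) =
      stoneProd D' (fun x => Q x ∧ readsBefore b x) := by
    refine stoneProd_congr hS _ fun x _ hx => h x ?_
    rintro rfl
    exact readsBefore_asymm hx.2 hx.2
  rw [stoneProd_split D' Q (hS ▸ hb) hQb hQ, stoneProd_split D Q hb hQb hQ, ← hpre, ← hpost,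
    uBox, uBox, if_neg hD', if_pos hD, mul_one, Equiv.swap_apply_apply, sbox, sw]
  group

theorem lt_rowLen_iff {n k : ℕ} (S : Shape n k) (r c : ℕ) :
    c < rowLen S r ↔ (r, c) ∈ S.boxes := by
  constructor
  · intro h
    by_contra hc
    have : rowLen S r ≤ (Finset.range c).card := by
      refine Finset.card_le_card fun x hx => ?_
      rw [Finset.mem_filter] at hx
      rw [Finset.mem_range]
      by_contra hcx
      exact hc (S.nw_closed _ hx.2 r c le_rfl (by simpa using hcx))
    rw [Finset.card_range] at this
    omega
  · intro h
    have : (Finset.range (c + 1)).card ≤ rowLen S r := by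
      refine Finset.card_le_card fun x hx => ?_
      rw [Finset.mem_range] at hx
      have hx' := S.nw_closed _ h r x le_rfl (by simp; omega)
      rw [Finset.mem_filter, Finset.mem_range]
      exact ⟨S.col_lt _ hx', hx'⟩
    rw [Finset.card_range] at this
    omega

theorem vlab_eq_lab {n k : ℕ} (S : Shape n k) {r c : ℕ} (h : (r, c) ∈ S.boxes)
    (h' : (r, c + 1) ∉ S.boxes) : vlab S r = lab n k (r, c) := by
  have h1 := (lt_rowLen_iff S r c).2 h
  have h2 := mt (lt_rowLen_iff S r (c + 1)).1 h'
  have h3 := S.col_lt _ h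
  simp only [vlab, lab] at *
  omega

theorem hlab_eq_lab {n k : ℕ} (S : Shape n k) {r c : ℕ} (h : (r, c) ∈ S.boxes)
    (h' : (r + 1, c) ∉ S.boxes) : hlab S c = lab n k (r, c) + 1 := by
  have h3 := S.col_lt _ h
  have : (Finset.range k).filter (fun r => c < rowLen S r) = Finset.range (r + 1) := by
    ext x
    rw [Finset.mem_filter, Finset.mem_range, Finset.mem_range, lt_rowLen_iff]
    constructor
    · rintro ⟨_, hx⟩
      by_contra hxr
      exact h' (S.nw_closed _ hx _ _ (by simpa using hxr) le_rfl)
    · intro hx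
      have hx' := S.nw_closed _ h x c (by simp; omega) le_rfl
      exact ⟨S.row_lt _ hx', hx'⟩
  simp only [hlab, lab, this, Finset.card_range] at *
  omega

/-- If no box read strictly between `y` and `b` moves position `i`, the pipe at position `i`
just before `b` is the one there just after `y`. -/
theorem prefixPerm_apply_of_fixed {n k : ℕ} (D : Diagram n k) {y b : ℕ × ℕ}
    (hy : y ∈ D.S.boxes) (hyb : readsBefore y b) (i : ℕ)
    (h : ∀ x ∈ D.S.boxes, readsBefore x b → readsBefore y x →
      i ≠ lab n k x ∧ i ≠ lab n k x + 1) :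
    prefixPerm D b i = prefixPerm D y (uBox D y i) := by
  rw [prefixPerm, stoneProd_split D _ hy hyb fun x hx => by unfold readsBefore at *; omega,
    Equiv.Perm.mul_apply, Equiv.Perm.mul_apply]
  congr 2
  apply readProd_apply_of_fixed
  intro x hx hx'
  rw [decide_eq_true_eq] at hx'
  exact h x hx hx'.1.1 hx'.1.2

theorem pipeAux_eq {n k : ℕ} (D : Diagram n k) (fuel : ℕ) (b : ℕ × ℕ) (hb : b ∈ D.S.boxes)
    (hf : (k - b.1) + (n - k - b.2) ≤ fuel) :
    pipeAux D fuel true b = prefixPerm D b (lab n k b + 1) ∧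
      pipeAux D fuel false b = prefixPerm D b (lab n k b) := by
  induction fuel generalizing b with
  | zero =>
    have := D.S.row_lt _ hb
    omega
  | succ fuel ih =>
    obtain ⟨r, c⟩ := b
    have hr := D.S.row_lt _ hb
    have hc := D.S.col_lt _ hb
    simp only at hr hc hf
    constructor
    · rw [pipeAux]
      dsimp only
      split_ifs with hy hp
      · rw [(ih _ hy (by simp only; omega)).2,
          prefixPerm_apply_of_fixed (b := (r, c)) D hy (Or.inl (by simp)), uBox, if_pos hp]
        · simp only [lab, Equiv.Perm.one_apply]; congr 1; omega
        · intro x hx h1 h2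
          have := D.S.col_lt _ hx
          simp only [lab, readsBefore] at *; omega
      · rw [(ih _ hy (by simp only; omega)).1,
          prefixPerm_apply_of_fixed (b := (r, c)) D hy (Or.inl (by simp)), uBox, if_neg hp]
        · have : lab n k (r, c) + 1 = lab n k (r + 1, c) := by simp only [lab]; omega
          rw [this, sbox, sw, Equiv.swap_apply_left]
        · intro x hx h1 h2
          have := D.S.col_lt _ hx
          simp only [lab, readsBefore] at *; omega
      · rw [hlab_eq_lab D.S hb hy]
        symm
        apply readProd_apply_of_fixed
        intro x hx hx'
        rw [decide_eq_true_eq] at hx'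
        have h1 : r + 1 ≤ x.1 → ¬ c ≤ x.2 := fun h1 h2 => hy (D.S.nw_closed _ hx _ _ h1 h2)
        have := D.S.col_lt _ hx
        simp only [lab, readsBefore] at *
        omega
    · rw [pipeAux]
      dsimp only
      split_ifs with hy hp
      · have hyc := D.S.col_lt _ hy
        rw [(ih _ hy (by simp only at *; omega)).1,
          prefixPerm_apply_of_fixed (b := (r, c)) D hy (Or.inr (by simp)), uBox, if_pos hp]
        · simp only [lab, Equiv.Perm.one_apply] at *; congr 1; omega
        · intro x hx h1 h2
          have := D.S.col_lt _ hx
          simp only [lab, readsBefore] at *; omega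
      · have hyc := D.S.col_lt _ hy
        rw [(ih _ hy (by simp only at *; omega)).2,
          prefixPerm_apply_of_fixed (b := (r, c)) D hy (Or.inr (by simp)), uBox, if_neg hp]
        · have : lab n k (r, c) = lab n k (r, c + 1) + 1 := by simp only [lab] at *; omega
          rw [this, sbox, sw, Equiv.swap_apply_right]
        · intro x hx h1 h2
          have := D.S.col_lt _ hx
          simp only [lab, readsBefore] at *; omega
      · rw [vlab_eq_lab D.S hb hy]
        symm
        apply readProd_apply_of_fixed
        intro x hx hx'
        rw [decide_eq_true_eq] at hx'
        have h1 : r ≤ x.1 → ¬ c + 1 ≤ x.2 := fun h1 h2 => hy (D.S.nw_closed _ hx _ _ h1 h2)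
        have := D.S.col_lt _ hx
        simp only [lab, readsBefore] at *
        omega

theorem pipePair_eq {n k : ℕ} (D : Diagram n k) {b : ℕ × ℕ} (hb : b ∈ D.S.boxes) :
    pipePair D b = {prefixPerm D b (lab n k b), prefixPerm D b (lab n k b + 1)} := by
  have hr := D.S.row_lt _ hb
  have hc := D.S.col_lt _ hb
  have h := pipeAux_eq D (n + 1) b hb (by omega)
  rw [pipePair, pipeB, pipeR, h.1, h.2, Finset.pair_comm]

theorem swap_eq_swap_of_pair_eq {a b c d : ℕ} (h : ({a, b} : Finset ℕ) = {c, d}) :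
    Equiv.swap a b = Equiv.swap c d := by
  have h' := congrArg (fun s : Finset ℕ => (s : Set ℕ)) h
  simp only [Finset.coe_pair, Set.pair_eq_pair_iff] at h'
  obtain ⟨rfl, rfl⟩ | ⟨rfl, rfl⟩ := h'
  · rfl
  · exact Equiv.swap_comm _ _

theorem pair_eq_pair_swap_apply {x y z w : ℕ} (h : ({x, y} : Finset ℕ) = {z, w} ∨
    ({Equiv.swap z w x, Equiv.swap z w y} : Finset ℕ) = {z, w}) :
    ({x, y} : Finset ℕ) = {Equiv.swap z w x, Equiv.swap z w y} := by
  have hinv : ∀ {a b : ℕ}, ({a, b} : Finset ℕ) = {z, w} →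
      ({Equiv.swap z w a, Equiv.swap z w b} : Finset ℕ) = {z, w} := by
    intro a b hab
    have := congrArg (Finset.image (Equiv.swap z w)) hab
    simpa [Finset.image_insert, Finset.pair_comm w z] using this
  obtain h | h := h
  · rw [hinv h, h]
  · rw [h]
    simpa using hinv h

/-- Placing a stone at `p` does not change the pair of pipes at a box through which the same
two pipes pass as at `p`. -/
theorem pipePair_toggle {n k : ℕ} {D D' : Diagram n k} (hS : D.S = D'.S) {p b : ℕ × ℕ}
    (hp : p ∈ D.S.boxes) (hb : b ∈ D.S.boxes) (hD : D.fill p = Fill.plus)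
    (hD' : D'.fill p ≠ Fill.plus)
    (h : ∀ x ≠ p, (D.fill x = Fill.plus ↔ D'.fill x = Fill.plus))
    (hpair : pipePair D b = pipePair D p ∨ pipePair D' b = pipePair D p) :
    pipePair D b = pipePair D' b := by
  by_cases hpb : readsBefore p b
  · have key := stoneProd_toggle hS (fun x => readsBefore x b) hp hpb
      (fun x hx => by unfold readsBefore at *; omega) hD hD' h
    change prefixPerm D' b = _ * prefixPerm D b at key
    rw [pipePair_eq D hb, pipePair_eq D hp, pipePair_eq D' (hS ▸ hb), key] at hpair
    rw [pipePair_eq D hb, pipePair_eq D' (hS ▸ hb), key]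
    simp only [Equiv.Perm.mul_apply] at *
    generalize prefixPerm D b (lab n k b) = x at *
    generalize prefixPerm D b (lab n k b + 1) = y at *
    generalize prefixPerm D p (lab n k p) = z at *
    generalize prefixPerm D p (lab n k p + 1) = w at *
    exact pair_eq_pair_swap_apply hpair
  · have key : prefixPerm D b = prefixPerm D' b := by
      refine stoneProd_congr hS _ fun x _ hx => h x ?_
      rintro rfl
      exact hpb hx
    rw [pipePair_eq D hb, pipePair_eq D' (hS ▸ hb), key]

theorem permU_eq_stoneProd {n k : ℕ} (D : Diagram n k) :
    permU D = stoneProd D (fun _ => True) := by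
  simp [permU, stoneProd]

theorem permU_toggle {n k : ℕ} {D D' : Diagram n k} (hS : D.S = D'.S) {p : ℕ × ℕ}
    (hp : p ∈ D.S.boxes) (hD : D.fill p = Fill.plus) (hD' : D'.fill p ≠ Fill.plus)
    (h : ∀ x ≠ p, (D.fill x = Fill.plus ↔ D'.fill x = Fill.plus)) :
    permU D' = Equiv.swap (prefixPerm D p (lab n k p)) (prefixPerm D p (lab n k p + 1)) *
      permU D := by
  rw [permU_eq_stoneProd, permU_eq_stoneProd]
  exact stoneProd_toggle hS _ hp trivial (fun _ _ => trivial) hD hD' h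

/-- The pair of pipes at `p` depends only on the boxes read before `p`. -/
theorem pipePair_congr {n k : ℕ} {D D' : Diagram n k} (hS : D.S = D'.S) {p : ℕ × ℕ}
    (hp : p ∈ D.S.boxes)
    (h : ∀ x ≠ p, (D.fill x = Fill.plus ↔ D'.fill x = Fill.plus)) :
    pipePair D p = pipePair D' p := by
  have key : prefixPerm D p = prefixPerm D' p := by
    refine stoneProd_congr hS _ fun x _ hx => h x ?_
    rintro rfl
    exact readsBefore_asymm hx hx
  rw [pipePair_eq D hp, pipePair_eq D' (hS ▸ hp), key]

theorem permU_flipPlusWith {n k : ℕ} (D : Diagram n k) (p t : ℕ × ℕ)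
    (h : IsFlipPair D p t) : permU (flipPlusWith D p t) = permU D := by
  obtain ⟨hp, hDp, -, w, hw, ht⟩ := h
  set D₁ := setFill D p Fill.white with hD₁
  have hfill₁ : ∀ x ≠ p, (D.fill x = Fill.plus ↔ D₁.fill x = Fill.plus) := by
    intro x hx
    simp [hD₁, setFill, hx]
  have hD₁p : D₁.fill p ≠ Fill.plus := by simp [hD₁, setFill]
  obtain ⟨hws, -, -, -, -, hpair, -⟩ := hw
  have hpp := pipePair_congr (D := D) (D' := D₁) rfl hp hfill₁
  have hpw : pipePair D w = pipePair D₁ w :=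
    pipePair_toggle (D := D) (D' := D₁) rfl hp hws.1 hDp hD₁p hfill₁ (Or.inr (hpair.trans hpp.symm))
  have htw : IsStone D₁ t ∧ pipePair D₁ t = pipePair D p := by
    obtain rfl | ⟨-, hts, -, -, -, hpair', -⟩ := ht
    · exact ⟨hws, hpair.trans hpp.symm⟩
    · have htp : t ≠ p := by
        rintro rfl
        exact hts.2 hDp
      have e : pipePair D t = pipePair D p :=
        hpair'.symm.trans (hpw.trans (hpair.trans hpp.symm))
      exact ⟨⟨hts.1, fun e => hts.2 ((hfill₁ t htp).2 e)⟩,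
        (pipePair_toggle (D := D) (D' := D₁) rfl hp hts.1 hDp hD₁p hfill₁ (Or.inl e)).symm.trans e⟩
  obtain ⟨hts, htpair⟩ := htw
  set D₂ := setFill D₁ t Fill.plus with hD₂
  have hfill₂ : ∀ x ≠ t, (D₂.fill x = Fill.plus ↔ D₁.fill x = Fill.plus) := by
    intro x hx
    simp [hD₂, setFill, hx]
  have hD₂t : D₂.fill t = Fill.plus := by simp [hD₂, setFill]
  have e₁ := permU_toggle (D := D) (D' := D₁) rfl hp hDp hD₁p hfill₁
  have e₂ := permU_toggle (D := D₂) (D' := D₁) rfl hts.1 hD₂t hts.2 hfill₂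
  have e₃ := pipePair_congr (D := D₂) (D' := D₁) rfl hts.1 hfill₂
  rw [htpair, pipePair_eq D hp, pipePair_eq D₂ hts.1] at e₃
  rw [swap_eq_swap_of_pair_eq e₃, e₁] at e₂
  have e₄ : permU (flipPlusWith D p t) = permU D₂ := by
    refine readProd_congr rfl fun x _ => ?_
    rw [decide_eq_decide, flipPlusWith, ← hD₁, ← hD₂]
    unfold recolor
    dsimp only
    split_ifs with h1 h2 <;> simp [h1]
  rw [e₄]
  exact (mul_left_cancel e₂).symm

/-- Corrective flips preserve the pair of permutations associated to
a diagram: the Ferrers shape (hence `v`) and the pipe-dream permutation `u`. -/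
theorem corrective_flip_preserves_permutations {n k : ℕ} (D D' : Diagram n k)
    (hB : BlackIffUncross D) (h : IsCorrectiveFlip D D') :
    D.S = D'.S ∧ permU D = permU D' := by
  obtain ⟨p, t, hpt, hS, hfill⟩ := h
  refine ⟨hS.symm, ?_⟩
  rw [← permU_flipPlusWith D p t hpt]
  refine (readProd_congr hS fun x hx => ?_).symm
  rw [hfill x hx]

end GoPaper
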